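/- Let ν > 0, let G have the centred Gamma distribution Γ̄_ν with density g_ν, let h : ℝ → ℝ be Lipschitz with Lipschitz constant at most 1, and set m = E[h(G)]. Define, for x > −ν, U_h(x) = (2(x+ν) g_ν(x))^{−1} ∫_{−ν}^{x} (h(y) − m) g_ν(y) dy. Then lim_{x → −ν⁺} U_h(x) = (h(−ν) − m)/ν; consequently the function equal to −(h(x) − m)/x for x ≤ −ν and to U_h(x) for x > −ν is continuous on all of ℝ. -/

import Mathlib

open MeasureTheory ProbabilityTheory Real intervalIntegral Filter Topology

/-- The centred Gamma distribution `Γ̄_ν`: the law of `2 F − ν` where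
`F` has the Gamma distribution with shape `ν/2` and rate `1`. -/
noncomputable def centeredGammaMeasure (ν : ℝ) : Measure ℝ :=
  (gammaMeasure (ν / 2) 1).map (fun x => 2 * x - ν)

/-- The density of the centred Gamma distribution `Γ̄_ν`. -/
noncomputable def centeredGammaPDFReal (ν x : ℝ) : ℝ :=
  if -ν < x then
    (2 : ℝ) ^ (-ν / 2) / Real.Gamma (ν / 2) * (x + ν) ^ (ν / 2 - 1) * Real.exp (-(x + ν) / 2)
  else 0

/-- The primitive in the Stein solution, rescaled to the unit interval. -/
theorem integral_mul_centeredGammaPDFReal (ν : ℝ) (f : ℝ → ℝ) {s : ℝ} (hs : 0 < s) :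
    ∫ y in (-ν)..(-ν + s), f y * centeredGammaPDFReal ν y =
      s * centeredGammaPDFReal ν (-ν + s) *
        ∫ t in (0 : ℝ)..1, f (-ν + s * t) * Real.exp (s * (1 - t) / 2) * t ^ (ν / 2 - 1) := by
  have hsub := smul_integral_comp_add_mul (a := 0) (b := 1)
    (fun y => f y * centeredGammaPDFReal ν y) s (-ν)
  simp only [mul_zero, add_zero, mul_one, smul_eq_mul] at hsub
  rw [← hsub, ← intervalIntegral.integral_const_mul, ← intervalIntegral.integral_const_mul]
  refine integral_congr_uIoo fun t ht => ?_
  rw [Set.uIoo_of_le zero_le_one] at ht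
  have hst : 0 < s * t := mul_pos hs ht.1
  have hexp : Real.exp (-(s * t) / 2) = Real.exp (-s / 2) * Real.exp (s * (1 - t) / 2) := by
    rw [← Real.exp_add]
    ring_nf
  simp only [centeredGammaPDFReal, lt_add_iff_pos_right, hst, hs, if_true, neg_add_cancel_comm,
    Real.mul_rpow hs.le ht.1.le, hexp]
  ring

theorem continuous_integral_mul_rpow {F : ℝ → ℝ → ℝ} (hF : Continuous (Function.uncurry F))
    {r : ℝ} (hr : -1 < r) : Continuous fun s => ∫ t in (0 : ℝ)..1, F s t * t ^ r := by
  have hint : IntervalIntegrable (fun t : ℝ => t ^ r) volume 0 1 := intervalIntegrable_rpow' hr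
  refine continuous_iff_continuousAt.2 fun s₀ => ?_
  obtain ⟨C, hC⟩ := ((isCompact_Icc (a := s₀ - 1) (b := s₀ + 1)).prod
    (isCompact_Icc (a := (0 : ℝ)) (b := 1))).exists_bound_of_continuousOn hF.continuousOn
  refine continuousAt_of_dominated_interval (bound := fun t => C * t ^ r) ?_ ?_
    (hint.const_mul C) ?_
  · refine Eventually.of_forall fun s => AEStronglyMeasurable.mul ?_ hint.def'.aestronglyMeasurable
    exact (hF.comp (Continuous.prodMk_right s)).aestronglyMeasurable
  · filter_upwards [Icc_mem_nhds (sub_one_lt s₀) (lt_add_one s₀)] with s hs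
    refine Eventually.of_forall fun t ht => ?_
    rw [Set.uIoc_of_le zero_le_one] at ht
    rw [norm_mul, Real.norm_of_nonneg (Real.rpow_nonneg ht.1.le r)]
    exact mul_le_mul_of_nonneg_right (hC (s, t) ⟨hs, ht.1.le, ht.2⟩) (Real.rpow_nonneg ht.1.le r)
  · refine Eventually.of_forall fun t _ => ContinuousAt.mul ?_ continuousAt_const
    exact (hF.comp (Continuous.prodMk_left t)).continuousAt

theorem centeredGammaPDFReal_pos {ν x : ℝ} (hν : 0 < ν) (hx : -ν < x) :
    0 < centeredGammaPDFReal ν x := by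
  have hxν : 0 < x + ν := by linarith
  have hΓ : 0 < Real.Gamma (ν / 2) := Real.Gamma_pos_of_pos (half_pos hν)
  rw [centeredGammaPDFReal, if_pos hx]
  positivity

/-- With `ν > 0`, `h` `1`-Lipschitz, `m = E[h(G)]` for `G ∼ Γ̄_ν`, and
`U_h(x) = (2(x+ν) g_ν(x))⁻¹ ∫_{−ν}^{x} (h(y) − m) g_ν(y) dy` on `(−ν, ∞)`:
`U_h(x) → (h(−ν) − m)/ν` as `x → −ν⁺`, and consequently the function equal to
`−(h(x) − m)/x` for `x ≤ −ν` and to `U_h(x)` for `x > −ν` is continuous on all of `ℝ`. -/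
theorem steinSolution_continuous
    (ν : ℝ) (hν : 0 < ν) (h : ℝ → ℝ) (hLip : LipschitzWith 1 h)
    (m : ℝ) (hm : m = ∫ x, h x ∂(centeredGammaMeasure ν))
    (U : ℝ → ℝ)
    (hU : ∀ x, -ν < x →
      U x = (2 * (x + ν) * centeredGammaPDFReal ν x)⁻¹
              * ∫ y in (-ν)..x, (h y - m) * centeredGammaPDFReal ν y) :
    Tendsto U (𝓝[>] (-ν)) (𝓝 ((h (-ν) - m) / ν)) ∧
    Continuous (fun x => if x ≤ -ν then -(h x - m) / x else U x) := by
  have hc : Continuous h := hLip.continuous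
  set V : ℝ → ℝ := fun s => 1 / 2 *
    ∫ t in (0 : ℝ)..1, ((h (-ν + s * t) - m) * Real.exp (s * (1 - t) / 2)) * t ^ (ν / 2 - 1)
  have hV : Continuous V := by
    refine continuous_const.mul (continuous_integral_mul_rpow
      (F := fun s t => (h (-ν + s * t) - m) * Real.exp (s * (1 - t) / 2)) ?_ (by linarith))
    simp only [Function.uncurry_def]
    fun_prop
  have hUV : ∀ x, -ν < x → U x = V (x + ν) := by
    intro x hx
    have hs : 0 < x + ν := by linarith
    have hg := centeredGammaPDFReal_pos hν hx
    have key := integral_mul_centeredGammaPDFReal ν (fun y => h y - m) hs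
    rw [show -ν + (x + ν) = x by ring] at key
    rw [hU x hx, key]
    simp only [V]
    field_simp
  have hV0 : V 0 = (h (-ν) - m) / ν := by
    have hν2 : -1 < ν / 2 - 1 := by linarith
    simp only [V, zero_mul, add_zero, zero_div, Real.exp_zero, mul_one,
      intervalIntegral.integral_const_mul, integral_rpow (Or.inl hν2), sub_add_cancel,
      Real.one_rpow, Real.zero_rpow (half_pos hν).ne', sub_zero]
    field_simp
  have hVν : Continuous fun x => V (x + ν) := hV.comp (continuous_add_const ν)
  constructor
  · have hlim : Tendsto (fun x => V (x + ν)) (𝓝[>] (-ν)) (𝓝 (V (-ν + ν))) :=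
      hVν.continuousAt.mono_left nhdsWithin_le_nhds
    rw [neg_add_cancel, hV0] at hlim
    refine hlim.congr' ?_
    filter_upwards [self_mem_nhdsWithin] with x hx
    exact (hUV x hx).symm
  · have hglue : (fun x => if x ≤ -ν then -(h x - m) / x else U x) =
        fun x => if x ≤ -ν then -(h x - m) / x else V (x + ν) := by
      funext x
      split_ifs with hx
      · rfl
      · exact hUV x (not_le.1 hx)
    rw [hglue]
    refine continuous_if_le continuous_id continuous_const ?_ hVν.continuousOn ?_
    · refine ContinuousOn.div (by fun_prop) continuousOn_id fun x hx => ?_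
      have hx' : x ≤ -ν := hx
      exact (by linarith : x < 0).ne
    · rintro x rfl
      simp only [neg_add_cancel, hV0, neg_div_neg_eq]
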